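/- arXiv:math/0102007 — 4 statements merged into one kernel-verified Lean document; each statement's English description precedes it below -/
import Mathlib

section
/- Let h be a real-valued function differentiable on [0,1] and set m = h(1) − h(0). If h'(0) < m and h'(1) < m, then there exists λ₀ ∈ (0,1) such that h(λ₀) = m·λ₀ + h(0) and h'(λ₀) ≥ m. -/
open Set Filter Topology

/-- A function with negative derivative at the left endpoint of an interval takes a smaller value
inside the interval. -/
lemma exists_lt_of_hasDerivWithinAt_neg_left {g : ℝ → ℝ} {g' u v : ℝ} (huv : u < v)
    (hg : HasDerivWithinAt g g' (Ioo u v) u) (hneg : g' < 0) :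
    ∃ x ∈ Ioo u v, g x < g u := by
  have hne : (𝓝[Ioo u v] u).NeBot := by
    rw [nhdsWithin_Ioo_eq_nhdsGT huv]; infer_instance
  rw [hasDerivWithinAt_iff_tendsto_slope' (by simp)] at hg
  obtain ⟨x, hx, hxm⟩ :=
    ((hg.eventually (gt_mem_nhds hneg)).and self_mem_nhdsWithin).exists
  refine ⟨x, hxm, ?_⟩
  rw [slope_def_field, div_neg_iff] at hx
  rcases hx with hx | hx <;> linarith [hxm.1, hx.1, hx.2]

/-- A function with negative derivative at the right endpoint of an interval takes a larger value
inside the interval. -/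
lemma exists_gt_of_hasDerivWithinAt_neg_right {g : ℝ → ℝ} {g' u v : ℝ} (huv : u < v)
    (hg : HasDerivWithinAt g g' (Ioo u v) v) (hneg : g' < 0) :
    ∃ x ∈ Ioo u v, g v < g x := by
  have hne : (𝓝[Ioo u v] v).NeBot := by
    rw [nhdsWithin_Ioo_eq_nhdsLT huv]; infer_instance
  rw [hasDerivWithinAt_iff_tendsto_slope' (by simp)] at hg
  obtain ⟨x, hx, hxm⟩ :=
    ((hg.eventually (gt_mem_nhds hneg)).and self_mem_nhdsWithin).exists
  refine ⟨x, hxm, ?_⟩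
  rw [slope_def_field, div_neg_iff] at hx
  rcases hx with hx | hx <;> linarith [hxm.2, hx.1, hx.2]

/-- A continuous function that is negative at `a` and nonnegative at `b` has a first zero. -/
lemma exists_first_zero {g : ℝ → ℝ} {a b : ℝ} (hab : a ≤ b) (hg : ContinuousOn g (Icc a b))
    (ha : g a < 0) (hb : 0 ≤ g b) :
    ∃ l ∈ Ioc a b, g l = 0 ∧ ∀ x ∈ Ico a l, g x < 0 := by
  have hcomp : IsCompact (Icc a b ∩ g ⁻¹' Ici 0) :=
    isCompact_Icc.of_isClosed_subset (hg.preimage_isClosed_of_isClosed isClosed_Icc isClosed_Ici)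
      inter_subset_left
  obtain ⟨l, ⟨hl, hgl⟩, hmin⟩ := hcomp.exists_isLeast ⟨b, right_mem_Icc.2 hab, hb⟩
  obtain ⟨c, hc, hgc⟩ := intermediate_value_Icc hl.1
    (hg.mono (Icc_subset_Icc_right hl.2)) ⟨ha.le, hgl⟩
  have hcl : c = l := le_antisymm hc.2 (hmin ⟨⟨hc.1, hc.2.trans hl.2⟩, hgc.ge⟩)
  subst hcl
  refine ⟨c, ⟨lt_of_le_of_ne hl.1 ?_, hl.2⟩, hgc, fun x hx => ?_⟩
  · rintro rfl
    exact ha.ne hgc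
  · by_contra! hgx
    exact hx.2.not_ge (hmin ⟨⟨hx.1, hx.2.le.trans hl.2⟩, hgx⟩)

/-- Let `h` be a real-valued function differentiable on `[0,1]` and set `m = h(1) − h(0)`.
If `h'(0) < m` and `h'(1) < m`, then there exists `λ₀ ∈ (0,1)` such that
`h(λ₀) = m·λ₀ + h(0)` and `h'(λ₀) ≥ m`. -/
theorem stmt_1 (h h' : ℝ → ℝ)
    (hdiff : ∀ x ∈ Set.Icc (0:ℝ) 1, HasDerivWithinAt h (h' x) (Set.Icc (0:ℝ) 1) x)
    (m : ℝ) (hm : m = h 1 - h 0) (h0 : h' 0 < m) (h1 : h' 1 < m) :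
    ∃ l ∈ Set.Ioo (0:ℝ) 1, h l = m * l + h 0 ∧ h' l ≥ m := by
  set g : ℝ → ℝ := fun x => h x - m * x - h 0 with hgdef
  have hg : ∀ x ∈ Icc (0:ℝ) 1, HasDerivWithinAt g (h' x - m) (Icc (0:ℝ) 1) x := fun x hx => by
    have hline : HasDerivWithinAt (fun y => m * y) m (Icc (0:ℝ) 1) x := by
      simpa using (hasDerivWithinAt_id x (Icc (0:ℝ) 1)).const_mul m
    exact ((hdiff x hx).sub hline).sub_const (h 0)
  have hg0 : g 0 = 0 := by simp [hgdef]
  have hg1 : g 1 = 0 := by simp [hgdef, hm]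
  have hsub : ∀ {u v : ℝ}, 0 ≤ u → v ≤ 1 → Ioo u v ⊆ Icc (0:ℝ) 1 :=
    fun hu hv => Ioo_subset_Icc_self.trans (Icc_subset_Icc hu hv)
  obtain ⟨a, ha, hga⟩ := exists_lt_of_hasDerivWithinAt_neg_left (v := 1 / 2) (by norm_num)
    ((hg 0 (by simp)).mono (hsub le_rfl (by norm_num))) (sub_neg.2 h0)
  obtain ⟨b, hb, hgb⟩ := exists_gt_of_hasDerivWithinAt_neg_right (u := 1 / 2) (by norm_num)
    ((hg 1 (by simp)).mono (hsub (by norm_num) le_rfl)) (sub_neg.2 h1)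
  rw [hg0] at hga
  rw [hg1] at hgb
  have hcont : ContinuousOn g (Icc a b) := fun x hx =>
    ((hg x (Icc_subset_Icc ha.1.le hb.2.le hx)).continuousWithinAt).mono
      (Icc_subset_Icc ha.1.le hb.2.le)
  obtain ⟨l, hl, hgl, hlt⟩ := exists_first_zero (ha.2.trans hb.1).le hcont hga hgb.le
  have hl01 : l ∈ Ioo (0:ℝ) 1 := ⟨ha.1.trans hl.1, hl.2.trans_lt hb.2⟩
  refine ⟨l, hl01, by simp only [hgdef] at hgl; linarith, ?_⟩
  by_contra! hneg
  obtain ⟨x, hx, hgx⟩ := exists_gt_of_hasDerivWithinAt_neg_right hl.1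
    ((hg l (Ioo_subset_Icc_self hl01)).mono (hsub ha.1.le hl01.2.le)) (sub_neg.2 hneg)
  exact (hlt x ⟨hx.1.le, hx.2⟩).not_gt (hgl ▸ hgx)
end

section
/- Let Ω be a closed convex subset of ℝⁿ and let f be a continuously differentiable real-valued function on Ω. For any points a, b ∈ Ω there exists a point c on the segment joining a and b (hence c ∈ Ω) such that g_c(a) ≤ f(a) and g_c(b) ≥ f(b). -/
open RealInnerProductSpace

/-- A function that is nonpositive at `0` and has negative derivative at each of its zeros in
`[0, 1]` is nonpositive on `[0, 1]`. -/
theorem nonpos_of_deriv_neg_at_zeros {ψ ψ' : ℝ → ℝ}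
    (hψ : ∀ t ∈ Set.Icc (0 : ℝ) 1, HasDerivAt ψ (ψ' t) t) (h0 : ψ 0 ≤ 0)
    (hneg : ∀ t ∈ Set.Icc (0 : ℝ) 1, ψ t = 0 → ψ' t < 0) :
    ∀ t ∈ Set.Icc (0 : ℝ) 1, ψ t ≤ 0 :=
  image_le_of_deriv_right_lt_deriv_boundary (B := fun _ => 0) (B' := fun _ => 0)
    (fun t ht => (hψ t ht).continuousAt.continuousWithinAt)
    (fun t ht => (hψ t (Set.Ico_subset_Icc_self ht)).hasDerivWithinAt) h0
    (fun t => hasDerivAt_const t 0)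
    (fun t ht => hneg t (Set.Ico_subset_Icc_self ht))

/-- A differentiable function vanishing at both endpoints of `[0, 1]` has a zero in `[0, 1]` at
which its derivative is nonnegative. -/
theorem exists_zero_deriv_nonneg {ψ ψ' : ℝ → ℝ}
    (hψ : ∀ t ∈ Set.Icc (0 : ℝ) 1, HasDerivAt ψ (ψ' t) t) (h0 : ψ 0 = 0) (h1 : ψ 1 = 0) :
    ∃ t ∈ Set.Icc (0 : ℝ) 1, ψ t = 0 ∧ 0 ≤ ψ' t := by
  by_contra! hneg
  have hle := nonpos_of_deriv_neg_at_zeros hψ h0.le hneg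
  have hmem : ∀ t ∈ Set.Icc (0 : ℝ) 1, 1 - t ∈ Set.Icc (0 : ℝ) 1 := fun t ht =>
    ⟨by linarith [ht.2], by linarith [ht.1]⟩
  have hge := nonpos_of_deriv_neg_at_zeros (ψ := fun t => -ψ (1 - t)) (ψ' := fun t => ψ' (1 - t))
    (fun t ht => by
      simpa using ((hψ (1 - t) (hmem t ht)).comp_const_sub 1 t).fun_neg)
    (by simp [h1]) (fun t ht h => hneg _ (hmem t ht) (neg_eq_zero.mp h))
  have hzero : ∀ t ∈ Set.Icc (0 : ℝ) 1, ψ t = 0 := fun t ht => by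
    have h := hge (1 - t) (hmem t ht)
    simp only [sub_sub_cancel] at h
    linarith [hle t ht]
  have hhalf : (1 / 2 : ℝ) ∈ Set.Icc (0 : ℝ) 1 := by constructor <;> norm_num
  have hev : ψ =ᶠ[nhds (1 / 2)] fun _ => 0 :=
    Filter.eventually_of_mem (Icc_mem_nhds (by norm_num) (by norm_num)) hzero
  have hderiv := (hψ _ hhalf).unique ((hasDerivAt_const _ (0 : ℝ)).congr_of_eventuallyEq hev)
  exact (hneg _ hhalf (hzero _ hhalf)).ne hderiv

/-- **Lemma 2** (Ovchinnikov). Let `Ω ⊆ ℝⁿ` be closed and convex and let `f` be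
continuously differentiable on `Ω` (it is `C¹` with gradient `∇f = f'`), with tangent
affine functions `g t x = ⟨∇f(t), x − t⟩ + f(t)`. For any `a, b ∈ Ω` there exists a
point `c` on the segment joining `a` and `b` (hence `c ∈ Ω`) such that
`g c a ≤ f a` and `g c b ≥ f b`. -/
theorem stmt_2 {n : ℕ} (Ω : Set (EuclideanSpace ℝ (Fin n)))
    (hΩclosed : IsClosed Ω) (hΩconv : Convex ℝ Ω)
    (f : EuclideanSpace ℝ (Fin n) → ℝ)
    (f' : EuclideanSpace ℝ (Fin n) → EuclideanSpace ℝ (Fin n))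
    (hf : ∀ t ∈ Ω, HasGradientAt f (f' t) t)
    (hf' : ContinuousOn f' Ω)
    (g : EuclideanSpace ℝ (Fin n) → EuclideanSpace ℝ (Fin n) → ℝ)
    (hg : ∀ t x, g t x = ⟪f' t, x - t⟫ + f t)
    (a b : EuclideanSpace ℝ (Fin n)) (ha : a ∈ Ω) (hb : b ∈ Ω) :
    ∃ c ∈ segment ℝ a b, g c a ≤ f a ∧ g c b ≥ f b := by
  have hseg : ∀ t ∈ Set.Icc (0 : ℝ) 1, AffineMap.lineMap a b t ∈ segment ℝ a b := fun t ht => by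
    rw [segment_eq_image_lineMap]
    exact Set.mem_image_of_mem _ ht
  obtain ⟨t, ht, hzero, hderiv⟩ := exists_zero_deriv_nonneg
    (ψ := fun t => f (AffineMap.lineMap a b t) - f a - t * (f b - f a))
    (ψ' := fun t => ⟪f' (AffineMap.lineMap a b t), b - a⟫ - (f b - f a))
    (fun t ht => by
      have h := (hf _ (hΩconv.segment_subset ha hb (hseg t ht))).hasFDerivAt.comp_hasDerivAt t
        (AffineMap.hasDerivAt_lineMap (a := a) (b := b))
      simpa using (h.sub_const (f a)).fun_sub ((hasDerivAt_id t).mul_const (f b - f a)))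
    (by simp) (by simp)
  refine ⟨_, hseg t ht, ?_⟩
  have hsuba : a - AffineMap.lineMap a b t = (-t) • (b - a) := by
    rw [AffineMap.lineMap_apply_module']; module
  have hsubb : b - AffineMap.lineMap a b t = (1 - t) • (b - a) := by
    rw [AffineMap.lineMap_apply_module']; module
  rw [hg, hg, hsuba, hsubb, real_inner_smul_right, real_inner_smul_right]
  constructor
  · nlinarith [mul_nonneg ht.1 hderiv]
  · nlinarith [mul_nonneg (sub_nonneg.mpr ht.2) hderiv]
end

section
/- Let Ω be a closed convex domain in ℝⁿ and let f be a continuously differentiable real-valued function on Ω. Then there exists an index set J and a family {S_j}_{j∈J} of subsets of Ω such that for every x ∈ Ω, f(x) = sup_{j∈J} inf_{t∈S_j} g_t(x), where the infima and the supremum are taken in the extended real numbers. -/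
open RealInnerProductSpace

/-- A differentiable function vanishing at both endpoints of `[0, 1]` has a zero at which its
derivative is nonpositive. -/
theorem exists_zero_deriv_nonpos {k k' : ℝ → ℝ}
    (hk : ∀ s ∈ Set.Icc (0 : ℝ) 1, HasDerivAt k (k' s) s) (h0 : k 0 = 0) (h1 : k 1 = 0) :
    ∃ s ∈ Set.Icc (0 : ℝ) 1, k s = 0 ∧ k' s ≤ 0 := by
  by_cases h : ∃ r ∈ Set.Icc (0 : ℝ) 1, k r < 0
  · obtain ⟨r, hr, hkr⟩ := h
    have hcont : ContinuousOn k (Set.Icc 0 r) := fun s hs =>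
      (hk s ⟨hs.1, hs.2.trans hr.2⟩).continuousAt.continuousWithinAt
    have hcomp : IsCompact (Set.Icc 0 r ∩ k ⁻¹' Set.Ici 0) :=
      isCompact_Icc.of_isClosed_subset
        (hcont.preimage_isClosed_of_isClosed isClosed_Icc isClosed_Ici) Set.inter_subset_left
    obtain ⟨s, ⟨hs, hks⟩, hmax⟩ :=
      hcomp.exists_isGreatest ⟨0, ⟨le_rfl, hr.1⟩, h0.ge⟩
    have hks : 0 ≤ k s := hks
    have hsr : s < r := lt_of_le_of_ne hs.2 (by rintro rfl; linarith)
    have hneg : ∀ᶠ y in nhdsWithin s (Set.Ioi s), k y < 0 := by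
      filter_upwards [Ioo_mem_nhdsGT hsr] with y hy
      by_contra! hky
      exact absurd (hmax ⟨⟨hs.1.trans hy.1.le, hy.2.le⟩, hky⟩) (not_le.2 hy.1)
    have hd := hk s ⟨hs.1, hs.2.trans hr.2⟩
    refine ⟨s, ⟨hs.1, hs.2.trans hr.2⟩, le_antisymm ?_ hks, ?_⟩
    · exact le_of_tendsto (hd.continuousAt.tendsto.mono_left nhdsWithin_le_nhds)
        (hneg.mono fun _ => le_of_lt)
    · refine le_of_tendsto ((hasDerivWithinAt_iff_tendsto_slope' Set.self_notMem_Ioi).1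
        hd.hasDerivWithinAt) ?_
      filter_upwards [hneg, self_mem_nhdsWithin] with y hy hsy
      rw [slope_def_field]
      exact div_nonpos_of_nonpos_of_nonneg (by linarith) (sub_nonneg.2 (le_of_lt hsy))
  · push Not at h
    have hmem : (1 : ℝ) ∈ Set.Icc (0 : ℝ) 1 := ⟨zero_le_one, le_rfl⟩
    refine ⟨1, hmem, h1, ?_⟩
    refine le_of_tendsto ((hasDerivWithinAt_iff_tendsto_slope' Set.self_notMem_Iio).1
      (hk 1 hmem).hasDerivWithinAt) ?_
    filter_upwards [Ioo_mem_nhdsLT (zero_lt_one (α := ℝ))] with y hy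
    rw [slope_def_field, h1, sub_zero]
    exact div_nonpos_of_nonneg_of_nonpos (h y ⟨hy.1.le, hy.2.le⟩) (by linarith [hy.2])

/-- Between two points `a`, `b` of a convex set there is a tangent of `f` lying above `f` at `a`
and below `f` at `b`. -/
theorem Convex.exists_tangent_ge_and_le {E : Type*} [NormedAddCommGroup E]
    [InnerProductSpace ℝ E] [CompleteSpace E] {Ω : Set E} (hΩ : Convex ℝ Ω) {f : E → ℝ}
    {f' : E → E} (hf : ∀ t ∈ Ω, HasGradientAt f (f' t) t) {a b : E} (ha : a ∈ Ω) (hb : b ∈ Ω) :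
    ∃ t ∈ Ω, f a ≤ ⟪f' t, a - t⟫ + f t ∧ ⟪f' t, b - t⟫ + f t ≤ f b := by
  have hmem : ∀ s ∈ Set.Icc (0 : ℝ) 1, AffineMap.lineMap a b s ∈ Ω := fun s hs =>
    hΩ.segment_subset ha hb (segment_eq_image_lineMap ℝ a b ▸ Set.mem_image_of_mem _ hs)
  obtain ⟨s, hs, hks, hks'⟩ := exists_zero_deriv_nonpos
    (k := fun s => f (AffineMap.lineMap a b s) - f a - s * (f b - f a))
    (k' := fun s => ⟪f' (AffineMap.lineMap a b s), b - a⟫ - (f b - f a))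
    (fun s hs => by
      have h := (hf _ (hmem s hs)).hasFDerivAt.comp_hasDerivAt s
        (AffineMap.hasDerivAt_lineMap (a := a) (b := b) (x := s))
      exact ((h.sub_const (f a)).sub ((hasDerivAt_id s).mul_const (f b - f a))).congr_deriv
        (by simp))
    (by simp) (by simp)
  have ha' : a - AffineMap.lineMap a b s = (-s) • (b - a) := by
    rw [AffineMap.lineMap_apply_module]; module
  have hb' : b - AffineMap.lineMap a b s = (1 - s) • (b - a) := by
    rw [AffineMap.lineMap_apply_module]; module
  refine ⟨_, hmem s hs, ?_, ?_⟩
  · rw [ha', inner_smul_right]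
    nlinarith [mul_nonneg hs.1 (neg_nonneg.2 hks')]
  · rw [hb', inner_smul_right]
    nlinarith [mul_nonneg (sub_nonneg.2 hs.2) (neg_nonneg.2 hks')]

/-- **Theorem 3.1** (Ovchinnikov). Let `Ω ⊆ ℝⁿ` be a closed convex domain (the closure of a
nonempty open convex set) and let `f` be continuously differentiable on `Ω`, with gradient
`f'` and tangent affine functions `g t x = ⟨∇f(t), x − t⟩ + f(t)`. Then there exist an index
set `J` and a family `S : J → Set _` of subsets of `Ω` such that for every `x ∈ Ω`,
`f(x) = ⨆ j, ⨅ t ∈ S j, g t x`, the suprema and infima being taken in the extended reals. -/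
theorem stmt_3 {n : ℕ} (U Ω : Set (EuclideanSpace ℝ (Fin n)))
    (hUopen : IsOpen U) (hUne : U.Nonempty) (hUconv : Convex ℝ U)
    (hΩ : Ω = closure U)
    (f : EuclideanSpace ℝ (Fin n) → ℝ)
    (f' : EuclideanSpace ℝ (Fin n) → EuclideanSpace ℝ (Fin n))
    (hf : ∀ t ∈ Ω, HasGradientAt f (f' t) t)
    (hf' : ContinuousOn f' Ω)
    (g : EuclideanSpace ℝ (Fin n) → EuclideanSpace ℝ (Fin n) → ℝ)
    (hg : ∀ t x, g t x = ⟪f' t, x - t⟫ + f t) :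
    ∃ (J : Type) (S : J → Set (EuclideanSpace ℝ (Fin n))),
      (∀ j, S j ⊆ Ω) ∧
      ∀ x ∈ Ω, (f x : EReal) = ⨆ j, ⨅ t ∈ S j, (g t x : EReal) := by
  have hΩconv : Convex ℝ Ω := hΩ ▸ hUconv.closure
  refine ⟨Ω, fun a => {t ∈ Ω | f a ≤ g t a}, fun _ _ ht => ht.1, fun x hx => le_antisymm ?_ ?_⟩
  · exact le_iSup_of_le ⟨x, hx⟩ (le_iInf₂ fun t ht => EReal.coe_le_coe ht.2)
  · refine iSup_le fun a => ?_
    obtain ⟨t, ht, hta, htx⟩ := hΩconv.exists_tangent_ge_and_le hf a.2 hx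
    exact iInf₂_le_of_le t ⟨ht, hta.trans_eq (hg t a).symm⟩
      (EReal.coe_le_coe ((hg t x).trans_le htx))
end

section
/- Let Ω be a closed convex domain in ℝⁿ, f continuously differentiable on Ω, and for u ∈ Ω set S_u = {t ∈ Ω : g_t(u) ≥ f(u)}. Then: (i) u ∈ S_u and g_u(u) = f(u), so inf_{t∈S_u} g_t(u) = f(u); and (ii) for every x ∈ Ω there exists v ∈ S_u with g_v(x) ≤ f(x), hence inf_{t∈S_u} g_t(x) ≤ f(x). -/
open RealInnerProductSpace

/-- A differentiable function vanishing at both ends of a segment has a zero in the segment at which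
its derivative is nonpositive. -/
theorem exists_zero_deriv_nonpos_s5 {a b : ℝ} (hab : a < b) {ψ ψ' : ℝ → ℝ}
    (h : ∀ s ∈ Set.Icc a b, HasDerivAt ψ (ψ' s) s) (ha : ψ a = 0) (hb : ψ b = 0) :
    ∃ s ∈ Set.Icc a b, ψ s = 0 ∧ ψ' s ≤ 0 := by
  by_contra! hc
  have hnonneg : ∀ ⦃s⦄, s ∈ Set.Icc a b → -ψ s ≤ 0 :=
    image_le_of_deriv_right_lt_deriv_boundary (f := fun s => -ψ s) (f' := fun s => -ψ' s)
      (B := fun _ => 0) (B' := fun _ => 0)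
      (fun s hs => (h s hs).continuousAt.neg.continuousWithinAt)
      (fun s hs => (h s ⟨hs.1, hs.2.le⟩).neg.hasDerivWithinAt)
      (by simp [ha]) (fun s => hasDerivAt_const s 0)
      (fun s hs h0 => neg_lt_zero.2 (hc s ⟨hs.1, hs.2.le⟩ (neg_eq_zero.1 h0)))
  have hbmem : b ∈ Set.Icc a b := ⟨hab.le, le_rfl⟩
  have hlim : Filter.Tendsto (slope ψ b) (nhdsWithin b (Set.Iio b)) (nhds (ψ' b)) :=
    (h b hbmem).tendsto_slope.mono_left (nhdsWithin_mono _ fun _ hs => ne_of_lt hs)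
  refine (hc b hbmem hb).not_ge (le_of_tendsto hlim ?_)
  filter_upwards [Ioo_mem_nhdsLT hab] with s hs
  rw [slope_def_field, hb, sub_zero]
  exact div_nonpos_of_nonneg_of_nonpos (neg_nonpos.1 (hnonneg ⟨hs.1.le, hs.2.le⟩))
    (sub_nonpos.2 hs.2.le)

/-- On the segment from `u` to `x` there is a point whose tangent affine function lies above `f`
at `u` and below `f` at `x`. -/
theorem exists_tangent_ge_left_le_right {E : Type*} [NormedAddCommGroup E]
    [InnerProductSpace ℝ E] [CompleteSpace E] {s : Set E} (hs : Convex ℝ s) {f : E → ℝ}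
    {f' : E → E} (hf : ∀ t ∈ s, HasGradientAt f (f' t) t) {u x : E} (hu : u ∈ s) (hx : x ∈ s) :
    ∃ v ∈ s, f u ≤ ⟪f' v, u - v⟫ + f v ∧ ⟪f' v, x - v⟫ + f v ≤ f x := by
  have hmem : ∀ r ∈ Set.Icc (0 : ℝ) 1, u + r • (x - u) ∈ s := fun r hr =>
    hs.add_smul_sub_mem hu hx hr
  have hderiv : ∀ r ∈ Set.Icc (0 : ℝ) 1,
      HasDerivAt (fun r : ℝ => f (u + r • (x - u)) - f u - r * (f x - f u))
        (⟪f' (u + r • (x - u)), x - u⟫ - (f x - f u)) r := by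
    intro r hr
    have hline : HasDerivAt (fun r : ℝ => u + r • (x - u)) (x - u) r := by
      simpa using ((hasDerivAt_id r).smul_const (x - u)).const_add u
    have hcomp := (hf _ (hmem r hr)).hasFDerivAt.comp_hasDerivAt r hline
    rw [InnerProductSpace.toDual_apply_apply] at hcomp
    exact (hcomp.sub_const (f u)).sub (hasDerivAt_mul_const (f x - f u))
  obtain ⟨r, hr, hzero, hle⟩ :=
    exists_zero_deriv_nonpos_s5 zero_lt_one hderiv (by simp) (by simp)
  refine ⟨_, hmem r hr, ?_, ?_⟩
  · have hvec : u - (u + r • (x - u)) = (-r) • (x - u) := by module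
    rw [hvec, inner_smul_right]
    nlinarith [mul_nonneg hr.1 (neg_nonneg.2 hle)]
  · have hvec : x - (u + r • (x - u)) = (1 - r) • (x - u) := by module
    rw [hvec, inner_smul_right]
    nlinarith [mul_nonneg (sub_nonneg.2 hr.2) (neg_nonneg.2 hle)]

/-- (Ovchinnikov, proof of Theorem 3.1.) Let `Ω ⊆ ℝⁿ` be a closed convex domain, `f`
continuously differentiable on `Ω` with gradient `f'`, `g t x = ⟨∇f(t), x − t⟩ + f(t)`,
and for `u ∈ Ω` let `S u = {t ∈ Ω : g t u ≥ f u}`. Then for every `u ∈ Ω`: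
(i) `u ∈ S u`, `g u u = f u`, and `⨅ t ∈ S u, g t u = f u`;
(ii) for every `x ∈ Ω` there is `v ∈ S u` with `g v x ≤ f x`, hence
`⨅ t ∈ S u, g t x ≤ f x` (infima in the extended reals). -/
theorem stmt_5 {n : ℕ} (U Ω : Set (EuclideanSpace ℝ (Fin n)))
    (hUopen : IsOpen U) (hUne : U.Nonempty) (hUconv : Convex ℝ U)
    (hΩ : Ω = closure U)
    (f : EuclideanSpace ℝ (Fin n) → ℝ)
    (f' : EuclideanSpace ℝ (Fin n) → EuclideanSpace ℝ (Fin n))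
    (hf : ∀ t ∈ Ω, HasGradientAt f (f' t) t)
    (hf' : ContinuousOn f' Ω)
    (g : EuclideanSpace ℝ (Fin n) → EuclideanSpace ℝ (Fin n) → ℝ)
    (hg : ∀ t x, g t x = ⟪f' t, x - t⟫ + f t)
    (S : EuclideanSpace ℝ (Fin n) → Set (EuclideanSpace ℝ (Fin n)))
    (hS : ∀ u, S u = {t ∈ Ω | g t u ≥ f u}) :
    ∀ u ∈ Ω,
      (u ∈ S u ∧ g u u = f u ∧ (⨅ t ∈ S u, (g t u : EReal)) = (f u : EReal)) ∧
      (∀ x ∈ Ω, (∃ v ∈ S u, g v x ≤ f x) ∧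
        (⨅ t ∈ S u, (g t x : EReal)) ≤ (f x : EReal)) := by
  intro u hu
  have hguu : g u u = f u := by simp [hg]
  have huS : u ∈ S u := by
    rw [hS]
    exact ⟨hu, hguu.ge⟩
  refine ⟨⟨huS, hguu, le_antisymm ?_ ?_⟩, fun x hx => ?_⟩
  · exact (iInf₂_le u huS).trans_eq (congrArg _ hguu)
  · refine le_iInf₂ fun t ht => ?_
    rw [hS] at ht
    exact EReal.coe_le_coe_iff.2 ht.2
  · have hΩconv : Convex ℝ Ω := hΩ ▸ hUconv.closure
    obtain ⟨v, hv, hvu, hvx⟩ := exists_tangent_ge_left_le_right hΩconv hf hu hx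
    have hvS : v ∈ S u := by
      rw [hS]
      exact ⟨hv, (hg v u).symm ▸ hvu⟩
    rw [← hg] at hvx
    exact ⟨⟨v, hvS, hvx⟩, (iInf₂_le v hvS).trans (EReal.coe_le_coe_iff.2 hvx)⟩
end
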